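/- For every natural number n ≥ 0, let M_n be the 5×5 matrix with nonnegative integer entries whose rows are (0, 0, n+2, n+1, 0), (0, 0, 0, 0, 1), (1, 0, 0, 0, 0), (0, 1, 0, 0, 0), and (0, 0, n+3, n+2, 0). Then every entry of M_n⁷ is strictly positive; in particular, M_n is Perron–Frobenius. -/

import Mathlib

/-- An `n × n` matrix with nonnegative integer entries is Perron–Frobenius if some
positive power of it has all entries strictly positive. -/
def IsPerronFrobenius {n : ℕ} (M : Matrix (Fin n) (Fin n) ℕ) : Prop :=
  ∃ N : ℕ, 0 < N ∧ ∀ i j, 0 < (M ^ N) i j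

/-- The transition matrix `M_n` of the train track map `f_n`. -/
def Mmat (n : ℕ) : Matrix (Fin 5) (Fin 5) ℕ :=
  !![0, 0, n + 2, n + 1, 0;
     0, 0, 0, 0, 1;
     1, 0, 0, 0, 0;
     0, 1, 0, 0, 0;
     0, 0, n + 3, n + 2, 0]

lemma Matrix.mul_apply_le_mul_apply {m : ℕ} {A B C D : Matrix (Fin m) (Fin m) ℕ}
    (hAB : ∀ i j, A i j ≤ B i j) (hCD : ∀ i j, C i j ≤ D i j) (i j : Fin m) :
    (A * C) i j ≤ (B * D) i j := by
  simp only [Matrix.mul_apply]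
  exact Finset.sum_le_sum fun k _ => Nat.mul_le_mul (hAB i k) (hCD k j)

lemma Matrix.pow_apply_le_pow_apply {m : ℕ} {A B : Matrix (Fin m) (Fin m) ℕ}
    (hAB : ∀ i j, A i j ≤ B i j) (k : ℕ) (i j : Fin m) :
    (A ^ k) i j ≤ (B ^ k) i j := by
  induction k generalizing i j with
  | zero => simp
  | succ k ih =>
    simp only [pow_succ]
    exact Matrix.mul_apply_le_mul_apply ih hAB i j

lemma Mmat_zero_apply_le (n : ℕ) (i j : Fin 5) : Mmat 0 i j ≤ Mmat n i j := by
  fin_cases i <;> fin_cases j <;> simp [Mmat]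

lemma Mmat_zero_pow_seven_pos (i j : Fin 5) : 0 < (Mmat 0 ^ 7) i j := by
  fin_cases i <;> fin_cases j <;> simp [Mmat, pow_succ]

theorem Mmat_seventh_power_positive (n : ℕ) :
    (∀ i j, 0 < ((Mmat n) ^ 7) i j) ∧ IsPerronFrobenius (Mmat n) := by
  have hpos : ∀ i j, 0 < ((Mmat n) ^ 7) i j := fun i j =>
    (Mmat_zero_pow_seven_pos i j).trans_le
      (Matrix.pow_apply_le_pow_apply (Mmat_zero_apply_le n) 7 i j)
  exact ⟨hpos, 7, by norm_num, hpos⟩
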